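/- Under the action of Aff(ℤ_{10}) on subsets of ℤ/10ℤ, the number of orbits of 5-element subsets that are both rigid (trivial affine stabilizer) and self-complementary is exactly 3. -/

import Mathlib

/-- The affine action of (u,v) on a subset of ℤ/nℤ. -/
def affActSet (n : ℕ) (u : ZMod n) (v : (ZMod n)ˣ) (S : Set (ZMod n)) : Set (ZMod n) :=
  (fun x => (v : ZMod n) * x + u) '' S

/-- The orbit of a subset of ℤ/nℤ under Aff(ℤ_n). -/
def affOrbit (n : ℕ) (S : Set (ZMod n)) : Set (Set (ZMod n)) :=
  {T | ∃ (u : ZMod n) (v : (ZMod n)ˣ), T = affActSet n u v S}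

/-- The subset of ℤ/10ℤ coded by the binary digits of `m`. -/
def bitSet (m : ℕ) : Set (ZMod 10) := {x | m.testBit x.val = true}

/-- Boolean test: `x ↦ v x + u` maps the set of `m` to that of `k` (complemented if `c`). -/
def chk (m k u v : ℕ) (c : Bool) : Bool :=
  (List.range 10).all fun x => m.testBit x == xor c (k.testBit ((v * x + u) % 10))

/-- Some affine map with the given Boolean property. -/
def anyAff (p : ℕ → ℕ → Bool) : Bool :=
  (List.range 10).any fun u => [1, 3, 7, 9].any fun v => p u v

theorem exists_bitSet (S : Set (ZMod 10)) : ∃ m < 1024, S = bitSet m := by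
  classical
  refine ⟨Nat.ofBits (fun i : Fin 10 => decide ((i : ZMod 10) ∈ S)),
    Nat.ofBits_lt_two_pow _, ?_⟩
  ext x
  have hx : x.val < 10 := ZMod.val_lt x
  simp only [bitSet, Set.mem_ofPred_eq]
  rw [Nat.testBit_ofBits_lt _ _ hx, decide_eq_true_iff]
  exact Iff.rfl

theorem aff_bij (u : ZMod 10) (v : (ZMod 10)ˣ) (S T : Set (ZMod 10)) :
    affActSet 10 u v S = T ↔ ∀ x, (x ∈ S ↔ (v : ZMod 10) * x + u ∈ T) := by
  constructor
  · rintro rfl x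
    constructor
    · intro hx
      exact ⟨x, hx, rfl⟩
    · rintro ⟨y, hy, h⟩
      have h2 : (v : ZMod 10) * y = v * x := add_right_cancel h
      rwa [← (Units.mul_right_inj v).1 h2]
  · intro h
    ext y
    constructor
    · rintro ⟨x, hx, rfl⟩
      exact (h x).1 hx
    · intro hy
      have e : (v : ZMod 10) * (((v⁻¹ : (ZMod 10)ˣ) : ZMod 10) * (y - u)) + u = y := by
        rw [Units.mul_inv_cancel_left]; ring
      exact ⟨_, (h _).2 (by rwa [e]), e⟩

theorem chk_iff (m k : ℕ) (u v : ZMod 10) (c : Bool) :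
    chk m k u.val v.val c = true ↔
      ∀ x : ZMod 10, m.testBit x.val = xor c (k.testBit (v * x + u).val) := by
  simp only [chk, List.all_eq_true, List.mem_range, beq_iff_eq]
  have key : ∀ x : ZMod 10, (v * x + u).val = (v.val * x.val + u.val) % 10 := by
    intro x
    rw [ZMod.val_add, ZMod.val_mul, Nat.mod_add_mod]
  constructor
  · intro h x
    rw [key]
    exact h _ (ZMod.val_lt x)
  · intro h x hx
    have := h (x : ZMod 10)
    rwa [key, ZMod.val_natCast_of_lt hx] at this

theorem act_iff (m k : ℕ) (u : ZMod 10) (v : (ZMod 10)ˣ) :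
    affActSet 10 u v (bitSet m) = bitSet k ↔
      chk m k u.val (v : ZMod 10).val false = true := by
  rw [aff_bij, chk_iff]
  refine forall_congr' fun x => ?_
  simp only [bitSet, Set.mem_ofPred_eq, Bool.false_xor]
  exact Bool.eq_iff_iff.symm

theorem act_compl_iff (m k : ℕ) (u : ZMod 10) (v : (ZMod 10)ˣ) :
    affActSet 10 u v (bitSet m) = (bitSet k)ᶜ ↔
      chk m k u.val (v : ZMod 10).val true = true := by
  rw [aff_bij, chk_iff]
  refine forall_congr' fun x => ?_
  simp only [bitSet, Set.mem_ofPred_eq, Set.mem_compl_iff, Bool.true_xor]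
  cases m.testBit x.val <;> cases k.testBit ((v : ZMod 10) * x + u).val <;> simp

theorem unit_val (v : (ZMod 10)ˣ) : (v : ZMod 10).val ∈ [1, 3, 7, 9] := by
  have h1 := ZMod.val_coe_unit_coprime v
  have h2 := ZMod.val_lt (v : ZMod 10)
  generalize (v : ZMod 10).val = n at h1 h2
  interval_cases n <;> revert h1 <;> decide

theorem anyAff_iff (p : ℕ → ℕ → Bool) :
    anyAff p = true ↔ ∃ (u : ZMod 10) (v : (ZMod 10)ˣ), p u.val (v : ZMod 10).val = true := by
  simp only [anyAff, List.any_eq_true, List.mem_range]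
  constructor
  · rintro ⟨u, hu, v, hv, h⟩
    have hc : Nat.Coprime v 10 ∧ v < 10 := by
      simp only [List.mem_cons, List.not_mem_nil, or_false] at hv
      rcases hv with rfl | rfl | rfl | rfl <;> decide
    refine ⟨(u : ZMod 10), ZMod.unitOfCoprime v hc.1, ?_⟩
    rwa [ZMod.coe_unitOfCoprime, ZMod.val_natCast_of_lt hu, ZMod.val_natCast_of_lt hc.2]
  · rintro ⟨u, v, h⟩
    exact ⟨_, ZMod.val_lt u, _, unit_val v, h⟩

/-- Rigidity and self-complementarity as a Boolean test. -/
def good (m : ℕ) : Bool :=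
  anyAff (fun u v => chk m m u v true) &&
    !anyAff (fun u v => !(u == 0 && v == 1) && chk m m u v false)

theorem good_iff (m : ℕ) : good m = true ↔
    (∀ (u : ZMod 10) (v : (ZMod 10)ˣ), affActSet 10 u v (bitSet m) = bitSet m → u = 0 ∧ v = 1) ∧
    (∃ (u : ZMod 10) (v : (ZMod 10)ˣ), affActSet 10 u v (bitSet m) = (bitSet m)ᶜ) := by
  have e1 : ∀ (u : ZMod 10) (v : (ZMod 10)ˣ),
      (u.val = 0 ∧ (v : ZMod 10).val = 1) ↔ (u = 0 ∧ v = 1) := by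
    intro u v
    rw [ZMod.val_eq_zero, ← Units.val_eq_one]
    refine and_congr_right fun _ => ⟨fun h => ZMod.val_injective 10 h, fun h => by rw [h]; rfl⟩
  rw [good, Bool.and_eq_true, Bool.not_eq_true', ← Bool.not_eq_true, anyAff_iff, anyAff_iff,
    and_comm]
  refine and_congr ?_ ?_
  · push Not
    refine forall_congr' fun u => forall_congr' fun v => ?_
    rw [act_iff, ← e1]
    cases chk m m u.val (v : ZMod 10).val false <;> simp
  · simp only [act_compl_iff]

/-- Comparison of one binary digit, written with the primitive operations on `ℕ` so that the
kernel evaluates it quickly. -/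
def cmpBit (m k u v x : ℕ) : Bool :=
  Nat.beq (Nat.land 1 (Nat.shiftRight m x))
    (Nat.land 1 (Nat.shiftRight k (Nat.mod (Nat.add (Nat.mul v x) u) 10)))

/-- Fast version of `chk` without complement. -/
def fastChk (m k u v : ℕ) : Bool :=
  and (cmpBit m k u v 0) <| and (cmpBit m k u v 1) <| and (cmpBit m k u v 2) <|
  and (cmpBit m k u v 3) <| and (cmpBit m k u v 4) <| and (cmpBit m k u v 5) <|
  and (cmpBit m k u v 6) <| and (cmpBit m k u v 7) <| and (cmpBit m k u v 8)
    (cmpBit m k u v 9)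

theorem cmpBit_eq (m k u v x : ℕ) :
    cmpBit m k u v x = (m.testBit x == k.testBit ((v * x + u) % 10)) := by
  have key : ∀ a b : ℕ, Nat.beq (1 &&& a) (1 &&& b) = ((1 &&& a != 0) == (1 &&& b != 0)) := by
    intro a b
    rw [Nat.one_and_eq_mod_two, Nat.one_and_eq_mod_two]
    rcases Nat.mod_two_eq_zero_or_one a with h | h <;>
      rcases Nat.mod_two_eq_zero_or_one b with h' | h' <;> rw [h, h'] <;> rfl
  exact key _ _

theorem fastChk_eq (m k u v : ℕ) : fastChk m k u v = chk m k u v false := by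
  have e : List.range 10 = [0, 1, 2, 3, 4, 5, 6, 7, 8, 9] := rfl
  simp only [fastChk, chk, e, List.all_cons, List.all_nil, Bool.and_true, cmpBit_eq,
    Bool.false_xor]

theorem fastChk_xor (m k u v : ℕ) : fastChk m (Nat.xor 1023 k) u v = chk m k u v true := by
  rw [fastChk_eq, Bool.eq_iff_iff]
  simp only [chk, List.all_eq_true, List.mem_range]
  refine forall_congr' fun x => forall_congr' fun _ => ?_
  have h1 : ∀ j < 10, Nat.testBit 1023 j = true := by decide
  have h2 : (Nat.xor 1023 k).testBit ((v * x + u) % 10) =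
      xor true (k.testBit ((v * x + u) % 10)) := by
    rw [← h1 _ (Nat.mod_lt (v * x + u) (by norm_num : 10 > 0))]
    exact Nat.testBit_xor _ _ _
  rw [h2, Bool.false_xor]

/-- Disjunction over the four units. -/
def fastUnits (p : ℕ → Bool) : Bool := or (p 1) <| or (p 3) <| or (p 7) (p 9)

/-- Fast version of `anyAff`. -/
def fastAny (p : ℕ → ℕ → Bool) : Bool :=
  or (fastUnits (p 0)) <| or (fastUnits (p 1)) <| or (fastUnits (p 2)) <|
  or (fastUnits (p 3)) <| or (fastUnits (p 4)) <| or (fastUnits (p 5)) <|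
  or (fastUnits (p 6)) <| or (fastUnits (p 7)) <| or (fastUnits (p 8)) (fastUnits (p 9))

theorem fastAny_eq (p : ℕ → ℕ → Bool) : fastAny p = anyAff p := by
  have e : List.range 10 = [0, 1, 2, 3, 4, 5, 6, 7, 8, 9] := rfl
  simp only [fastAny, fastUnits, anyAff, e, List.any_cons, List.any_nil, Bool.or_false]

/-- The test that is evaluated for every code `m`. -/
def classify (m : ℕ) : Bool :=
  or (not (fastAny fun u v => fastChk m (Nat.xor 1023 m) u v)) <|
  or (fastAny fun u v => and (not (and (Nat.beq u 0) (Nat.beq v 1))) (fastChk m m u v)) <|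
  or (fastAny fun u v => fastChk 47 m u v) <|
  or (fastAny fun u v => fastChk 87 m u v) (fastAny fun u v => fastChk 103 m u v)

/-- Conjunction of `p` over the numbers below `n`. -/
def allBelow (p : ℕ → Bool) (n : ℕ) : Bool :=
  Nat.rec true (fun i r => and (p i) r) n

theorem allBelow_spec (p : ℕ → Bool) (n : ℕ) (h : allBelow p n = true) :
    ∀ m < n, p m = true := by
  induction n with
  | zero => intro m hm; omega
  | succ n ih =>
    have h' : (p n && allBelow p n) = true := h
    rw [Bool.and_eq_true] at h'
    intro m hm
    rcases Nat.lt_succ_iff_lt_or_eq.1 hm with h1 | rfl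
    · exact ih h'.2 m h1
    · exact h'.1

theorem classify_all : allBelow classify 1024 = true := by
  decide +kernel

theorem good_cases (m : ℕ) (hm : m < 1024) (hg : good m = true) :
    anyAff (fun u v => chk 47 m u v false) = true ∨
    anyAff (fun u v => chk 87 m u v false) = true ∨
    anyAff (fun u v => chk 103 m u v false) = true := by
  have h := allBelow_spec classify 1024 classify_all m hm
  simp only [classify, fastAny_eq, fastChk_xor, Bool.or_eq_true] at h
  simp only [fastChk_eq] at h
  rw [good, Bool.and_eq_true] at hg
  obtain ⟨h1, h2⟩ := hg
  rcases h with h | h | h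
  · rw [h1] at h
    exact absurd h (by decide)
  · have h3 : anyAff (fun u v => !(u == 0 && v == 1) && chk m m u v false) = true := h
    rw [h3] at h2
    exact absurd h2 (by decide)
  · exact h

theorem orbit_le (S : Set (ZMod 10)) (u : ZMod 10) (v : (ZMod 10)ˣ) :
    affOrbit 10 (affActSet 10 u v S) ⊆ affOrbit 10 S := by
  rintro _ ⟨u', v', rfl⟩
  refine ⟨v' * u + u', v' * v, ?_⟩
  simp only [affActSet, Set.image_image, Units.val_mul]
  congr 1
  ext x
  ring

theorem orbit_eq (S : Set (ZMod 10)) (u : ZMod 10) (v : (ZMod 10)ˣ) :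
    affOrbit 10 (affActSet 10 u v S) = affOrbit 10 S := by
  refine (orbit_le S u v).antisymm ?_
  have h := orbit_le (affActSet 10 u v S) (-(((v⁻¹ : (ZMod 10)ˣ) : ZMod 10) * u)) v⁻¹
  have e : affActSet 10 (-(((v⁻¹ : (ZMod 10)ˣ) : ZMod 10) * u)) v⁻¹ (affActSet 10 u v S) = S := by
    simp only [affActSet, Set.image_image, mul_add, Units.inv_mul_cancel_left,
      add_neg_cancel_right, Set.image_id']
  rwa [e] at h

theorem orbit_bit_iff (m k : ℕ) : affOrbit 10 (bitSet k) = affOrbit 10 (bitSet m) ↔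
    anyAff (fun u v => chk m k u v false) = true := by
  rw [anyAff_iff]
  constructor
  · intro h
    have h0 : bitSet k ∈ affOrbit 10 (bitSet k) :=
      ⟨0, 1, by simp [affActSet]⟩
    rw [h] at h0
    obtain ⟨u, v, e⟩ := h0
    exact ⟨u, v, (act_iff _ _ _ _).1 e.symm⟩
  · rintro ⟨u, v, h⟩
    rw [← (act_iff _ _ _ _).2 h, orbit_eq]

theorem bitSet_ncard (m : ℕ) :
    (bitSet m).ncard = (Finset.univ.filter fun x : ZMod 10 => m.testBit x.val = true).card := by
  rw [← Set.ncard_coe_finset]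
  congr 1
  ext x
  simp [bitSet]

/-- there are exactly 3 orbits of 5-element subsets of ℤ/10ℤ
that are both rigid and self-complementary under Aff(ℤ_10). -/
theorem strong_dichotomy_ten :
    Nat.card {O : Set (Set (ZMod 10)) | ∃ S : Set (ZMod 10),
      O = affOrbit 10 S ∧ S.ncard = 5 ∧
      (∀ (u : ZMod 10) (v : (ZMod 10)ˣ), affActSet 10 u v S = S → u = 0 ∧ v = 1) ∧
      (∃ (u : ZMod 10) (v : (ZMod 10)ˣ), affActSet 10 u v S = Sᶜ)} = 3 := by
  have hset : {O : Set (Set (ZMod 10)) | ∃ S : Set (ZMod 10),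
      O = affOrbit 10 S ∧ S.ncard = 5 ∧
      (∀ (u : ZMod 10) (v : (ZMod 10)ˣ), affActSet 10 u v S = S → u = 0 ∧ v = 1) ∧
      (∃ (u : ZMod 10) (v : (ZMod 10)ˣ), affActSet 10 u v S = Sᶜ)} =
      {affOrbit 10 (bitSet 47), affOrbit 10 (bitSet 87), affOrbit 10 (bitSet 103)} := by
    ext O
    simp only [Set.mem_ofPred_eq, Set.mem_insert_iff, Set.mem_singleton_iff]
    constructor
    · rintro ⟨S, rfl, -, h⟩
      obtain ⟨m, hm, rfl⟩ := exists_bitSet S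
      rw [orbit_bit_iff, orbit_bit_iff, orbit_bit_iff]
      exact good_cases m hm ((good_iff m).2 h)
    · rintro (rfl | rfl | rfl)
      · exact ⟨_, rfl, by rw [bitSet_ncard]; decide +kernel, (good_iff 47).1 (by decide +kernel)⟩
      · exact ⟨_, rfl, by rw [bitSet_ncard]; decide +kernel, (good_iff 87).1 (by decide +kernel)⟩
      · exact ⟨_, rfl, by rw [bitSet_ncard]; decide +kernel, (good_iff 103).1 (by decide +kernel)⟩
  rw [hset, Nat.card_coe_set_eq, Set.ncard_eq_three]
  refine ⟨_, _, _, ?_, ?_, ?_, rfl⟩ <;> rw [Ne, orbit_bit_iff] <;> decide +kernel
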